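/- Suppose the dealer is a member of the Vamos pair A (e.g., the dealer is v1, so the access structure is V1 = Γ_{v1}). Then for any perfect secret sharing scheme, 16 ≤ 5·h(A|B) + h(B|A) + 6·h(A|C) + 2·h(B|D). -/

import Mathlib

open MeasureTheory Finset

/-- Shannon entropy of a random variable with values in a finite type:
`H(f) = ∑ₐ −P(f = a)·log P(f = a)`. -/
noncomputable def shannonEntropy {Ω : Type} [MeasurableSpace Ω] {α : Type} [Fintype α]
    (μ : Measure Ω) (f : Ω → α) : ℝ :=
  ∑ a : α, Real.negMulLog ((μ (f ⁻¹' {a})).toReal)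

/-- A family of random variables on a common probability space: one (finite-valued)
random variable `secret` for the secret, and one random variable `share p` for the
share of each participant `p`. -/
structure Scheme (P : Type) [Fintype P] [DecidableEq P] where
  (Ω : Type)
  [mΩ : MeasurableSpace Ω]
  (μ : Measure Ω)
  [prob : IsProbabilityMeasure μ]
  (SecT : Type)
  [secFin : Fintype SecT]
  (ShT : P → Type)
  [shFin : ∀ p, Fintype (ShT p)]
  (secret : Ω → SecT)
  (share : (p : P) → Ω → ShT p)
  (secret_meas : ∀ s : Set SecT, MeasurableSet (secret ⁻¹' s))
  (share_meas : ∀ p, ∀ s : Set (ShT p), MeasurableSet (share p ⁻¹' s))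

namespace Scheme

variable {P : Type} [Fintype P] [DecidableEq P]

/-- `H(S)`: the entropy of the secret. -/
noncomputable def Hsec (S : Scheme P) : ℝ :=
  letI := S.mΩ; letI := S.secFin
  shannonEntropy S.μ S.secret

/-- `H(X)`: the joint entropy of the shares of the participants in `X`. -/
noncomputable def Hset (S : Scheme P) (X : Finset P) : ℝ :=
  letI := S.mΩ; letI := S.shFin
  shannonEntropy S.μ (fun ω => fun p : {y // y ∈ X} => S.share p.1 ω)

/-- `H(X ∪ {S})`: the joint entropy of the shares of the participants in `X`
together with the secret. -/
noncomputable def HsetS (S : Scheme P) (X : Finset P) : ℝ :=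
  letI := S.mΩ; letI := S.secFin; letI := S.shFin
  shannonEntropy S.μ (fun ω => ((fun p : {y // y ∈ X} => S.share p.1 ω), S.secret ω))

/-- The normalized entropy `h(X) = H(X)/H(S)`. -/
noncomputable def hset (S : Scheme P) (X : Finset P) : ℝ := S.Hset X / S.Hsec

/-- The conditional normalized entropy `h(X|Y) = h(X ∪ Y) − h(Y)`. -/
noncomputable def hcond (S : Scheme P) (X Y : Finset P) : ℝ :=
  S.hset (X ∪ Y) - S.hset Y

/-- `Σ` is a perfect secret sharing scheme for the access structure `Γ`:
the conditional entropy `H(S|X) = H(X ∪ {S}) − H(X)` equals `0` for every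
qualified set `X` and equals `H(S)` for every unqualified set `X`. -/
def IsPerfect (S : Scheme P) (Γ : Finset P → Prop) : Prop :=
  (∀ X : Finset P, Γ X → S.HsetS X - S.Hset X = 0) ∧
  (∀ X : Finset P, ¬ Γ X → S.HsetS X - S.Hset X = S.Hsec)

end Scheme
/-- The four Vamos pairs `A = {v₁,v₂}`, `B = {v₃,v₄}`, `C = {v₅,v₆}`, `D = {v₇,v₈}`,
where participant `vᵢ` is represented by `(i-1 : Fin 8)`. -/
def pairA : Finset (Fin 8) := {0, 1}
def pairB : Finset (Fin 8) := {2, 3}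
def pairC : Finset (Fin 8) := {4, 5}
def pairD : Finset (Fin 8) := {6, 7}

/-- `X` is one of the four Vamos pairs. -/
def IsVamosPair (X : Finset (Fin 8)) : Prop :=
  X = pairA ∨ X = pairB ∨ X = pairC ∨ X = pairD

/-- The dependent sets of the Vamos matroid: the five special four-element sets
`AB`, `AC`, `BC`, `BD`, `CD`, and all sets with at least five elements. -/
def VamosDep (X : Finset (Fin 8)) : Prop :=
  X = pairA ∪ pairB ∨ X = pairA ∪ pairC ∨ X = pairB ∪ pairC ∨
    X = pairB ∪ pairD ∨ X = pairC ∪ pairD ∨ 5 ≤ X.card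

/-- The circuits of the Vamos matroid: minimal dependent sets. -/
def VamosCircuit (X : Finset (Fin 8)) : Prop :=
  VamosDep X ∧ ∀ Y ⊂ X, ¬ VamosDep Y

/-- The access structure `Γₓ` induced by the Vamos matroid with dealer `x`
(the dealer is regarded as a participant who is individually qualified):
a set is qualified iff it contains a minimal qualified set, the minimal
qualified sets being `{x}` and the sets `M ⊆ Q \ {x}` with `M ∪ {x}` a circuit. -/
def VamosQualified (x : Fin 8) (Y : Finset (Fin 8)) : Prop :=
  x ∈ Y ∨ ∃ M ⊆ Y, x ∉ M ∧ VamosCircuit (insert x M)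

/-- `λ = (max₁≤ᵢ≤₈ h({vᵢ})) − 1`. -/
noncomputable def Scheme.lam (S : Scheme (Fin 8)) : ℝ :=
  (Finset.univ.sup' Finset.univ_nonempty fun i : Fin 8 => S.hset {i}) - 1

/-- The information rate `ρ(Σ) = min₁≤ᵢ≤₈ H(S)/H(vᵢ)` of a scheme. -/
noncomputable def Scheme.rho (S : Scheme (Fin 8)) : ℝ :=
  Finset.univ.inf' Finset.univ_nonempty fun i : Fin 8 => S.Hsec / S.Hset {i}

section FiniteEntropy

variable {Ω α β γ : Type} [Fintype Ω]

open Classical in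
/-- The total weight of the points on which `f` takes the same value as at `ω`. -/
noncomputable def fiberMass (w : Ω → ℝ) (f : Ω → α) (ω : Ω) : ℝ :=
  ∑ a with f a = f ω, w a

/-- The Shannon entropy of `f` with respect to the weights `w` on a finite type. -/
noncomputable def weightedEntropy (w : Ω → ℝ) (f : Ω → α) : ℝ :=
  -∑ ω, w ω * Real.log (fiberMass w f ω)

variable {w : Ω → ℝ}

theorem le_fiberMass (hw : ∀ ω, 0 ≤ w ω) (f : Ω → α) (ω : Ω) : w ω ≤ fiberMass w f ω :=
  Finset.single_le_sum (f := w) (fun i _ => hw i) (by simp)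

theorem fiberMass_congr {f : Ω → α} {ω₁ ω₂ : Ω} (h : f ω₁ = f ω₂) :
    fiberMass w f ω₁ = fiberMass w f ω₂ := by
  unfold fiberMass
  rw [h]

theorem fiberMass_mono (hw : ∀ ω, 0 ≤ w ω) {f : Ω → α} {g : Ω → β} {ω : Ω}
    (h : ∀ ω', g ω' = g ω → f ω' = f ω) : fiberMass w g ω ≤ fiberMass w f ω := by
  classical
  refine Finset.sum_le_sum_of_subset_of_nonneg (fun a => ?_) fun a _ _ => hw a
  simpa using h a

/-- Entropy depends only on which points of the support a function identifies. -/
theorem weightedEntropy_congr {f : Ω → α} {g : Ω → β}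
    (h : ∀ ω ω', w ω ≠ 0 → w ω' ≠ 0 → (f ω' = f ω ↔ g ω' = g ω)) :
    weightedEntropy w f = weightedEntropy w g := by
  classical
  unfold weightedEntropy
  congr 1
  refine Finset.sum_congr rfl fun ω _ => ?_
  by_cases h0 : w ω = 0
  · simp [h0]
  · congr 2
    simp only [fiberMass, Finset.sum_filter]
    refine Finset.sum_congr rfl fun ω' _ => ?_
    by_cases h1 : w ω' = 0
    · simp [h1]
    · simp only [h ω ω' h0 h1]

theorem weightedEntropy_mono (hw : ∀ ω, 0 ≤ w ω) {f : Ω → α} {g : Ω → β}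
    (h : ∀ ω ω', g ω' = g ω → f ω' = f ω) : weightedEntropy w f ≤ weightedEntropy w g := by
  refine neg_le_neg (Finset.sum_le_sum fun ω _ => ?_)
  rcases (hw ω).eq_or_lt with h0 | h0
  · simp [← h0]
  · exact mul_le_mul_of_nonneg_left
      (Real.log_le_log (h0.trans_le (le_fiberMass hw g ω)) (fiberMass_mono hw (h ω))) h0.le

theorem sum_mul_fiberMass_div_le (hw : ∀ ω, 0 ≤ w ω) {p : Ω → α} {q : Ω → β} {r : Ω → γ}
    {δ : Type} {k : Ω → δ} (hr : ∀ ω ω', r ω' = r ω ↔ p ω' = p ω ∧ q ω' = q ω)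
    (hp : ∀ ω ω', p ω' = p ω → k ω' = k ω) (hq : ∀ ω ω', q ω' = q ω → k ω' = k ω) :
    ∑ ω, w ω * (fiberMass w p ω * fiberMass w q ω / (fiberMass w r ω * fiberMass w k ω))
      ≤ ∑ ω, w ω := by
  classical
  have hm : ∀ {δ : Type} (f : Ω → δ) ω, 0 ≤ fiberMass w f ω :=
    fun f ω => (hw ω).trans (le_fiberMass hw f ω)
  have inner (ω₁ ω₂ : Ω) :
      ∑ ω, (if p ω₁ = p ω ∧ q ω₂ = q ω then w ω / (fiberMass w r ω * fiberMass w k ω) else 0)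
        ≤ if k ω₂ = k ω₁ then (fiberMass w k ω₁)⁻¹ else 0 := by
    by_cases hex : ∃ ω₀, p ω₁ = p ω₀ ∧ q ω₂ = q ω₀
    · obtain ⟨ω₀, h1, h2⟩ := hex
      have hk1 := hp _ _ h1
      have hk2 := hq _ _ h2
      rw [if_pos (hk2.trans hk1.symm), fiberMass_congr hk1]
      calc _ = ∑ ω with r ω = r ω₀, w ω / (fiberMass w r ω₀ * fiberMass w k ω₀) := by
            rw [Finset.sum_filter]
            refine Finset.sum_congr rfl fun ω _ => ?_
            have e : (p ω₁ = p ω ∧ q ω₂ = q ω) ↔ r ω = r ω₀ := by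
              rw [hr, h1, h2]; exact and_congr eq_comm eq_comm
            by_cases h : r ω = r ω₀
            · rw [if_pos (e.2 h), if_pos h, fiberMass_congr h,
                fiberMass_congr (hp _ _ ((hr _ _).1 h).1)]
            · rw [if_neg (mt e.1 h), if_neg h]
        _ = fiberMass w r ω₀ / fiberMass w r ω₀ * (fiberMass w k ω₀)⁻¹ := by
            rw [← Finset.sum_div, ← fiberMass, div_mul_eq_div_div, div_eq_mul_inv]
        _ ≤ _ := mul_le_of_le_one_left (inv_nonneg.2 (hm k ω₀)) (div_self_le_one _)
    · push Not at hex
      rw [Finset.sum_eq_zero fun ω _ => if_neg fun h => hex ω h.1 h.2]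
      split_ifs
      · exact inv_nonneg.2 (hm k ω₁)
      · exact le_rfl
  calc _ = ∑ ω, ∑ ω₁, ∑ ω₂, w ω₁ * w ω₂ *
          (if p ω₁ = p ω ∧ q ω₂ = q ω then w ω / (fiberMass w r ω * fiberMass w k ω) else 0) := by
        refine Finset.sum_congr rfl fun ω _ => ?_
        rw [show w ω * (fiberMass w p ω * fiberMass w q ω / (fiberMass w r ω * fiberMass w k ω))
            = fiberMass w p ω * fiberMass w q ω * (w ω / (fiberMass w r ω * fiberMass w k ω)) by
              ring]
        conv_lhs => rw [fiberMass, fiberMass, Finset.sum_filter, Finset.sum_filter,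
          Finset.sum_mul_sum, Finset.sum_mul]
        refine Finset.sum_congr rfl fun ω₁ _ => ?_
        rw [Finset.sum_mul]
        refine Finset.sum_congr rfl fun ω₂ _ => ?_
        by_cases h1 : p ω₁ = p ω <;> by_cases h2 : q ω₂ = q ω <;> simp [h1, h2]
    _ = ∑ ω₁, ∑ ω₂, w ω₁ * w ω₂ * ∑ ω,
          (if p ω₁ = p ω ∧ q ω₂ = q ω then w ω / (fiberMass w r ω * fiberMass w k ω) else 0) := by
        simp only [Finset.mul_sum]
        rw [Finset.sum_comm]
        exact Finset.sum_congr rfl fun ω₁ _ => Finset.sum_comm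
    _ ≤ ∑ ω₁, ∑ ω₂, w ω₁ * w ω₂ * (if k ω₂ = k ω₁ then (fiberMass w k ω₁)⁻¹ else 0) :=
        Finset.sum_le_sum fun ω₁ _ => Finset.sum_le_sum fun ω₂ _ =>
          mul_le_mul_of_nonneg_left (inner ω₁ ω₂) (mul_nonneg (hw _) (hw _))
    _ = ∑ ω₁, w ω₁ * (fiberMass w k ω₁ / fiberMass w k ω₁) := by
        refine Finset.sum_congr rfl fun ω₁ _ => ?_
        conv_rhs =>
          rw [← mul_div_assoc]
          arg 1
          rw [fiberMass, Finset.sum_filter, Finset.mul_sum]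
        rw [Finset.sum_div]
        refine Finset.sum_congr rfl fun ω₂ _ => ?_
        split_ifs <;> ring
    _ ≤ ∑ ω, w ω := Finset.sum_le_sum fun ω _ =>
        mul_le_of_le_one_right (hw ω) (div_self_le_one _)

theorem weightedEntropy_submodular (hw : ∀ ω, 0 ≤ w ω) {p : Ω → α} {q : Ω → β} {r : Ω → γ}
    {δ : Type} {k : Ω → δ} (hr : ∀ ω ω', r ω' = r ω ↔ p ω' = p ω ∧ q ω' = q ω)
    (hp : ∀ ω ω', p ω' = p ω → k ω' = k ω) (hq : ∀ ω ω', q ω' = q ω → k ω' = k ω) :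
    weightedEntropy w r + weightedEntropy w k ≤ weightedEntropy w p + weightedEntropy w q := by
  have key : ∀ ω, w ω * Real.log (fiberMass w p ω) + w ω * Real.log (fiberMass w q ω)
      - w ω * Real.log (fiberMass w r ω) - w ω * Real.log (fiberMass w k ω)
      ≤ w ω * (fiberMass w p ω * fiberMass w q ω / (fiberMass w r ω * fiberMass w k ω)) - w ω := by
    intro ω
    rcases (hw ω).eq_or_lt with h0 | h0
    · simp [← h0]
    · have hm {δ : Type} (f : Ω → δ) : 0 < fiberMass w f ω := h0.trans_le (le_fiberMass hw f ω)
      have hlog := Real.log_le_sub_one_of_pos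
        (div_pos (mul_pos (hm p) (hm q)) (mul_pos (hm r) (hm k)))
      rw [Real.log_div (mul_pos (hm p) (hm q)).ne' (mul_pos (hm r) (hm k)).ne',
        Real.log_mul (hm p).ne' (hm q).ne', Real.log_mul (hm r).ne' (hm k).ne'] at hlog
      nlinarith [mul_le_mul_of_nonneg_left hlog h0.le]
  have hsum := Finset.sum_le_sum fun ω (_ : ω ∈ Finset.univ) => key ω
  simp only [Finset.sum_sub_distrib, Finset.sum_add_distrib] at hsum
  have hle := sum_mul_fiberMass_div_le hw hr hp hq
  unfold weightedEntropy
  linarith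

/-- The weights on `Ω × Ω` of two points drawn conditionally independently given a common
value of `k`, each distributed according to `w`. -/
noncomputable def copyWeight (w : Ω → ℝ) (k : Ω → α) (z : Ω × Ω) : ℝ :=
  open Classical in if k z.2 = k z.1 then w z.1 * w z.2 / fiberMass w k z.1 else 0

theorem copyWeight_nonneg (hw : ∀ ω, 0 ≤ w ω) (k : Ω → α) (z : Ω × Ω) :
    0 ≤ copyWeight w k z := by
  unfold copyWeight
  split_ifs
  · exact div_nonneg (mul_nonneg (hw _) (hw _)) ((hw _).trans (le_fiberMass hw k _))
  · exact le_rfl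

theorem eq_of_copyWeight_ne_zero {k : Ω → α} {z : Ω × Ω} (h : copyWeight w k z ≠ 0) :
    k z.2 = k z.1 := by
  by_contra hne
  exact h (if_neg hne)

theorem copyWeight_swap (k : Ω → α) (z : Ω × Ω) :
    copyWeight w k z.swap = copyWeight w k z := by
  unfold copyWeight
  by_cases h : k z.2 = k z.1
  · simp only [Prod.fst_swap, Prod.snd_swap, if_pos h, if_pos h.symm, fiberMass_congr h, mul_comm]
  · simp only [Prod.fst_swap, Prod.snd_swap, if_neg h, if_neg (Ne.symm h)]

theorem sum_copyWeight (hw : ∀ ω, 0 ≤ w ω) (k : Ω → α) (a : Ω) :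
    ∑ b, copyWeight w k (a, b) = w a := by
  classical
  have h : ∑ b, copyWeight w k (a, b) = w a * (fiberMass w k a / fiberMass w k a) := by
    conv_rhs =>
      rw [← mul_div_assoc]
      arg 1
      rw [fiberMass, Finset.sum_filter, Finset.mul_sum]
    rw [Finset.sum_div]
    refine Finset.sum_congr rfl fun b _ => ?_
    unfold copyWeight
    split_ifs <;> ring
  rw [h]
  rcases (hw a).eq_or_lt with h0 | h0
  · simp [← h0]
  · rw [div_self (h0.trans_le (le_fiberMass hw k a)).ne', mul_one]

theorem sum_copyWeight_mul_fst (hw : ∀ ω, 0 ≤ w ω) (k : Ω → α) (F : Ω → ℝ) :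
    ∑ z, copyWeight w k z * F z.1 = ∑ a, w a * F a := by
  rw [Fintype.sum_prod_type]
  refine Finset.sum_congr rfl fun a _ => ?_
  rw [← sum_copyWeight hw k a, Finset.sum_mul]

theorem sum_copyWeight_mul_snd (hw : ∀ ω, 0 ≤ w ω) (k : Ω → α) (F : Ω → ℝ) :
    ∑ z, copyWeight w k z * F z.2 = ∑ a, w a * F a := by
  rw [← sum_copyWeight_mul_fst hw k F, ← (Equiv.prodComm Ω Ω).sum_comp]
  refine Finset.sum_congr rfl fun z _ => ?_
  rw [Equiv.prodComm_apply, copyWeight_swap, Prod.snd_swap]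

theorem weightedEntropy_copyWeight_fst (hw : ∀ ω, 0 ≤ w ω) (k : Ω → α) (f : Ω → β) :
    weightedEntropy (copyWeight w k) (fun z => f z.1) = weightedEntropy w f := by
  classical
  unfold weightedEntropy
  rw [← sum_copyWeight_mul_fst hw k]
  congr 1
  refine Finset.sum_congr rfl fun z _ => ?_
  congr 2
  have h := sum_copyWeight_mul_fst hw k fun a => if f a = f z.1 then 1 else 0
  simpa [fiberMass, Finset.sum_filter] using h

theorem weightedEntropy_copyWeight_snd (hw : ∀ ω, 0 ≤ w ω) (k : Ω → α) (f : Ω → β) :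
    weightedEntropy (copyWeight w k) (fun z => f z.2) = weightedEntropy w f := by
  classical
  unfold weightedEntropy
  rw [← sum_copyWeight_mul_snd hw k]
  congr 1
  refine Finset.sum_congr rfl fun z _ => ?_
  congr 2
  have h := sum_copyWeight_mul_snd hw k fun a => if f a = f z.2 then 1 else 0
  simpa [fiberMass, Finset.sum_filter] using h

theorem weightedEntropy_copyWeight_prod (hw : ∀ ω, 0 ≤ w ω) {k : Ω → α} {f : Ω → β} {g : Ω → γ}
    (hf : ∀ ω ω', f ω' = f ω → k ω' = k ω) (hg : ∀ ω ω', g ω' = g ω → k ω' = k ω) :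
    weightedEntropy (copyWeight w k) (fun z => (f z.1, g z.2))
      = weightedEntropy w f + weightedEntropy w g - weightedEntropy w k := by
  classical
  have mass (z : Ω × Ω) (hz : k z.2 = k z.1) :
      fiberMass (copyWeight w k) (fun z => (f z.1, g z.2)) z
        = fiberMass w f z.1 * fiberMass w g z.2 / fiberMass w k z.1 := by
    simp only [fiberMass.eq_def w f, fiberMass.eq_def w g, fiberMass.eq_def (copyWeight w k),
      Finset.sum_filter]
    rw [Fintype.sum_prod_type, Finset.sum_mul_sum, Finset.sum_div]
    refine Finset.sum_congr rfl fun a _ => ?_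
    rw [Finset.sum_div]
    refine Finset.sum_congr rfl fun b _ => ?_
    by_cases h1 : f a = f z.1
    · by_cases h2 : g b = g z.2
      · have ha := hf _ _ h1
        have hb := hg _ _ h2
        simp [h1, h2, copyWeight, hb.trans (hz.trans ha.symm), fiberMass_congr ha]
      · simp [h2]
    · simp [h1]
  have term (z : Ω × Ω) : copyWeight w k z *
      Real.log (fiberMass (copyWeight w k) (fun z => (f z.1, g z.2)) z)
      = copyWeight w k z * Real.log (fiberMass w f z.1)
        + copyWeight w k z * Real.log (fiberMass w g z.2)
        - copyWeight w k z * Real.log (fiberMass w k z.1) := by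
    by_cases h0 : copyWeight w k z = 0
    · simp [h0]
    · have hz := eq_of_copyWeight_ne_zero h0
      have h1 : w z.1 ≠ 0 := fun h => h0 (by simp [copyWeight, h])
      have h2 : w z.2 ≠ 0 := fun h => h0 (by simp [copyWeight, h])
      have hm {δ : Type} (u : Ω → δ) {ω : Ω} (h : w ω ≠ 0) : fiberMass w u ω ≠ 0 :=
        (((hw ω).lt_of_ne' h).trans_le (le_fiberMass hw u ω)).ne'
      rw [mass z hz, Real.log_div (mul_ne_zero (hm f h1) (hm g h2)) (hm k h1),
        Real.log_mul (hm f h1) (hm g h2)]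
      ring
  simp only [weightedEntropy, term, Finset.sum_add_distrib, Finset.sum_sub_distrib]
  rw [sum_copyWeight_mul_fst hw k fun a => Real.log (fiberMass w f a),
    sum_copyWeight_mul_snd hw k fun a => Real.log (fiberMass w g a),
    sum_copyWeight_mul_fst hw k fun a => Real.log (fiberMass w k a)]
  ring

end FiniteEntropy

section JointEntropy

variable {Ω α ι : Type}

/-- The joint entropy of the members of the family `X` with index in `S`. -/
noncomputable def jointEntropy [Fintype Ω] (w : Ω → ℝ) (X : ι → Ω → α) (S : Finset ι) : ℝ :=
  weightedEntropy w fun ω (i : S) => X i ω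

theorem restrict_eq_iff {X : ι → Ω → α} {S : Finset ι} {ω ω' : Ω} :
    ((fun i : S => X i ω') = fun i : S => X i ω) ↔ ∀ i ∈ S, X i ω' = X i ω := by
  simp [funext_iff]

variable [Fintype Ω] {w : Ω → ℝ}

theorem jointEntropy_mono (hw : ∀ ω, 0 ≤ w ω) (X : ι → Ω → α) {S T : Finset ι} (h : S ⊆ T) :
    jointEntropy w X S ≤ jointEntropy w X T := by
  refine weightedEntropy_mono hw fun ω ω' => ?_
  simp only [restrict_eq_iff]
  exact fun H i hi => H i (h hi)

theorem jointEntropy_submodular [DecidableEq ι] (hw : ∀ ω, 0 ≤ w ω) (X : ι → Ω → α)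
    (S T : Finset ι) :
    jointEntropy w X (S ∪ T) + jointEntropy w X (S ∩ T)
      ≤ jointEntropy w X S + jointEntropy w X T := by
  refine weightedEntropy_submodular hw (fun ω ω' => ?_) (fun ω ω' => ?_) fun ω ω' => ?_ <;>
    simp only [restrict_eq_iff, Finset.mem_union, Finset.mem_inter]
  · exact ⟨fun H => ⟨fun i hi => H i (.inl hi), fun i hi => H i (.inr hi)⟩,
      fun H i hi => hi.elim (H.1 i) (H.2 i)⟩
  · exact fun H i hi => H i hi.1
  · exact fun H i hi => H i hi.2

/-- Joint entropies of blocks of random variables are joint entropies of a single family. -/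
theorem jointEntropy_biUnion {κ : Type} [DecidableEq ι] (w : Ω → ℝ) (X : ι → Ω → α)
    (G : κ → Finset ι) (S : Finset κ) :
    jointEntropy w (fun (n : κ) ω (i : ι) => if i ∈ G n then some (X i ω) else none) S
      = jointEntropy w X (S.biUnion G) := by
  refine weightedEntropy_congr fun ω ω' _ _ => ?_
  rw [restrict_eq_iff (X := X),
    restrict_eq_iff (X := fun (n : κ) ω i => if i ∈ G n then some (X i ω) else none)]
  simp only [Finset.mem_biUnion, funext_iff]
  constructor
  · rintro H i ⟨n, hn, hi⟩
    simpa [hi] using H n hn i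
  · intro H n hn i
    by_cases hi : i ∈ G n
    · simp [hi, H i ⟨n, hn, hi⟩]
    · simp [hi]

/-- The copy lemma: a family can be enlarged by a fresh variable `n` which is a copy of the
variable `j` over the variables in `O`, conditionally independent of the whole family. -/
theorem exists_copy [DecidableEq ι] (hw : ∀ ω, 0 ≤ w ω) (X : ι → Ω → α) (O : Finset ι)
    (j n : ι) (hn : n ∉ O) :
    ∃ (w' : Ω × Ω → ℝ) (X' : ι → Ω × Ω → α), (∀ z, 0 ≤ w' z) ∧
      (∀ S, n ∉ S → jointEntropy w' X' S = jointEntropy w X S) ∧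
      (∀ S ⊆ O, jointEntropy w' X' (insert n S) = jointEntropy w X (insert j S)) ∧
      ∀ S, n ∉ S → O ⊆ S → jointEntropy w' X' (insert n S)
        = jointEntropy w X S + jointEntropy w X (insert j O) - jointEntropy w X O := by
  set k : Ω → O → α := fun ω i => X i ω with hk
  set X' : ι → Ω × Ω → α := Function.update (fun i z => X i z.1) n fun z => X j z.2 with hX'
  have hXn : X' n = fun z => X j z.2 := Function.update_self ..
  have hXi {i : ι} (hi : i ≠ n) : X' i = fun z => X i z.1 := Function.update_of_ne hi ..
  have hO {z : Ω × Ω} (hz : copyWeight w k z ≠ 0) : ∀ i ∈ O, X i z.2 = X i z.1 :=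
    restrict_eq_iff.1 (eq_of_copyWeight_ne_zero hz)
  refine ⟨copyWeight w k, X', copyWeight_nonneg hw k, fun S hS => ?_, fun S hS => ?_,
    fun S hS hOS => ?_⟩
  · unfold jointEntropy
    rw [← weightedEntropy_copyWeight_fst hw k]
    refine weightedEntropy_congr fun z z' _ _ => ?_
    simp only [restrict_eq_iff]
    refine forall₂_congr fun i hi => ?_
    rw [hXi (ne_of_mem_of_not_mem hi hS)]
  · unfold jointEntropy
    rw [← weightedEntropy_copyWeight_snd hw k]
    refine weightedEntropy_congr fun z z' hz hz' => ?_
    simp only [restrict_eq_iff, Finset.forall_mem_insert, hXn]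
    refine and_congr_right fun _ => forall₂_congr fun i hi => ?_
    rw [hXi (ne_of_mem_of_not_mem (hS hi) hn), hO hz i (hS hi), hO hz' i (hS hi)]
  · unfold jointEntropy
    rw [← weightedEntropy_copyWeight_prod (k := k) hw (fun ω ω' => ?_) fun ω ω' => ?_]
    · refine weightedEntropy_congr fun z z' hz hz' => ?_
      simp only [restrict_eq_iff, Finset.forall_mem_insert, hXn, Prod.mk.injEq]
      constructor
      · rintro ⟨h1, h2⟩
        have h2' : ∀ i ∈ S, X i z'.1 = X i z.1 := fun i hi => by
          simpa [hXi (ne_of_mem_of_not_mem hi hS)] using h2 i hi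
        exact ⟨h2', h1, fun i hi => by rw [hO hz i hi, hO hz' i hi, h2' i (hOS hi)]⟩
      · rintro ⟨h1, h2, -⟩
        exact ⟨h2, fun i hi => by simpa [hXi (ne_of_mem_of_not_mem hi hS)] using h1 i hi⟩
    · simp only [hk, restrict_eq_iff]
      exact fun H i hi => H i (hOS hi)
    · simp only [hk, restrict_eq_iff, Finset.forall_mem_insert]
      exact fun H => H.2

end JointEntropy

section NonShannon

variable {Ω α : Type} [Fintype Ω] {w : Ω → ℝ}

/-- A non-Shannon information inequality for the four random variables `X 0, X 1, X 2, X 3`, in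
the usual notation `2 I(0;1) ≤ 3 I(0;1|2) + 3 I(0;2|1) + 3 I(1;2|0) + 2 I(0;1|3) + 2 I(2;3)`. -/
theorem jointEntropy_nonShannon (hw : ∀ ω, 0 ≤ w ω) (X : ℕ → Ω → α) :
    0 ≤ -5 * jointEntropy w X {0} - 5 * jointEntropy w X {1} - jointEntropy w X {2}
      + 8 * jointEntropy w X {1, 0} + 6 * jointEntropy w X {2, 0} + 6 * jointEntropy w X {2, 1}
      - 9 * jointEntropy w X {2, 1, 0} + 2 * jointEntropy w X {3, 0} + 2 * jointEntropy w X {3, 1}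
      - 2 * jointEntropy w X {3, 2} - 2 * jointEntropy w X {3, 1, 0} := by
  obtain ⟨w₁, X₁, hw₁, eq₁, copy₁, indep₁⟩ := exists_copy hw X {2, 1} 0 4 (by decide)
  obtain ⟨w₂, X₂, hw₂, eq₂, copy₂, indep₂⟩ := exists_copy hw₁ X₁ {2, 0} 4 5 (by decide)
  have eq (S : Finset ℕ) (h₄ : 4 ∉ S) (h₅ : 5 ∉ S) : jointEntropy w X S = jointEntropy w₂ X₂ S :=
    ((eq₂ S h₅).trans (eq₁ S h₄)).symm
  have sub (S T U V : Finset ℕ) (hU : S ∪ T = U) (hV : S ∩ T = V) : jointEntropy w₂ X₂ U +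
      jointEntropy w₂ X₂ V ≤ jointEntropy w₂ X₂ S + jointEntropy w₂ X₂ T :=
    hU ▸ hV ▸ jointEntropy_submodular hw₂ X₂ S T
  have copyR (S T : Finset ℕ) (hS : S ⊆ {2, 1})
      (hT : insert 0 S = T ∧ 5 ∉ insert 4 S ∧ 4 ∉ T ∧ 5 ∉ T) :
      jointEntropy w₂ X₂ (insert 4 S) = jointEntropy w₂ X₂ T := by
    rw [eq₂ _ hT.2.1, copy₁ S hS, hT.1, eq T hT.2.2.1 hT.2.2.2]
  have indepR (S : Finset ℕ) (hS : {2, 1} ⊆ S) (hn : 4 ∉ S ∧ 5 ∉ insert 4 S ∧ 5 ∉ S) :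
      jointEntropy w₂ X₂ (insert 4 S) = jointEntropy w₂ X₂ S + jointEntropy w₂ X₂ {2, 1, 0}
        - jointEntropy w₂ X₂ {2, 1} := by
    rw [eq₂ _ hn.2.1, indep₁ S hn.1 hS, ← eq S hn.1 hn.2.2, ← eq {2, 1} (by decide) (by decide),
      ← eq {2, 1, 0} (by decide) (by decide),
      show insert 0 {2, 1} = ({2, 1, 0} : Finset ℕ) by decide]
  have copyS (S T : Finset ℕ) (hS : S ⊆ {2, 0}) (hT : insert 4 S = T ∧ 5 ∉ T) :
      jointEntropy w₂ X₂ (insert 5 S) = jointEntropy w₂ X₂ T := by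
    rw [copy₂ S hS, hT.1, eq₂ T hT.2]
  have indepS (S : Finset ℕ) (hS : {2, 0} ⊆ S) (hn : 5 ∉ S) :
      jointEntropy w₂ X₂ (insert 5 S) = jointEntropy w₂ X₂ S + jointEntropy w₂ X₂ {4, 2, 0}
        - jointEntropy w₂ X₂ {2, 0} := by
    rw [indep₂ S hn hS, eq₂ S hn, eq₂ {2, 0} (by decide), eq₂ {4, 2, 0} (by decide)]
  rw [eq {0} (by decide) (by decide),
    eq {1} (by decide) (by decide),
    eq {2} (by decide) (by decide),
    eq {1, 0} (by decide) (by decide),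
    eq {2, 0} (by decide) (by decide),
    eq {2, 1} (by decide) (by decide),
    eq {2, 1, 0} (by decide) (by decide),
    eq {3, 0} (by decide) (by decide),
    eq {3, 1} (by decide) (by decide),
    eq {3, 2} (by decide) (by decide),
    eq {3, 1, 0} (by decide) (by decide)]
  have r : jointEntropy w₂ X₂ {4} = jointEntropy w₂ X₂ {0} :=
    copyR ∅ {0} (by decide) (by decide)
  have s : jointEntropy w₂ X₂ {5} = jointEntropy w₂ X₂ {4} :=
    copyS ∅ {4} (by decide) (by decide)
  linarith [r,
    s,
    copyS {0} {4, 0} (by decide) (by decide),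
    copyR {1} {1, 0} (by decide) (by decide),
    copyR {2} {2, 0} (by decide) (by decide),
    copyS {2} {4, 2} (by decide) (by decide),
    indepR {2, 1, 0} (by decide) (by decide),
    indepS {2, 1, 0} (by decide) (by decide),
    indepS {3, 2, 0} (by decide) (by decide),
    indepR {3, 2, 1} (by decide) (by decide),
    indepR {3, 2, 1, 0} (by decide) (by decide),
    indepS {3, 2, 1, 0} (by decide) (by decide),
    sub {4, 3, 0} {4, 3, 1} {4, 3, 1, 0} {4, 3} (by decide) (by decide),
    sub {5, 3, 0} {5, 3, 1} {5, 3, 1, 0} {5, 3} (by decide) (by decide),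
    sub {5, 1, 0} {5, 2, 1} {5, 2, 1, 0} {5, 1} (by decide) (by decide),
    sub {1, 0} {4, 1} {4, 1, 0} {1} (by decide) (by decide),
    sub {3, 2, 0} {5, 3, 2} {5, 3, 2, 0} {3, 2} (by decide) (by decide),
    sub {4, 1, 0} {4, 2, 0} {4, 2, 1, 0} {4, 0} (by decide) (by decide),
    sub {3, 2, 1} {4, 3, 2} {4, 3, 2, 1} {3, 2} (by decide) (by decide),
    sub {1, 0} {5, 0} {5, 1, 0} {0} (by decide) (by decide),
    sub {2, 1} {5, 2} {5, 2, 1} {2} (by decide) (by decide),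
    sub {4, 2} {4, 3} {4, 3, 2} {4} (by decide) (by decide),
    sub {5, 2} {5, 3} {5, 3, 2} {5} (by decide) (by decide),
    sub {3, 2, 1, 0} {4, 3, 1, 0} {4, 3, 2, 1, 0} {3, 1, 0} (by decide) (by decide),
    sub {3, 2, 1, 0} {5, 3, 1, 0} {5, 3, 2, 1, 0} {3, 1, 0} (by decide) (by decide),
    sub {3, 0} {4, 0} {4, 3, 0} {0} (by decide) (by decide),
    sub {3, 1} {4, 1} {4, 3, 1} {1} (by decide) (by decide),
    sub {3, 0} {5, 0} {5, 3, 0} {0} (by decide) (by decide),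
    sub {3, 1} {5, 1} {5, 3, 1} {1} (by decide) (by decide)]

end NonShannon

section Scheme

theorem shannonEntropy_comp {Ω Ω₀ α : Type} [MeasurableSpace Ω] [Fintype Ω₀] [Fintype α]
    (μ : Measure Ω) [IsFiniteMeasure μ] {Z : Ω → Ω₀} (hZ : ∀ z, MeasurableSet (Z ⁻¹' {z}))
    (F : Ω₀ → α) :
    shannonEntropy μ (fun ω => F (Z ω)) = weightedEntropy (fun z => μ.real (Z ⁻¹' {z})) F := by
  classical
  have key (a : α) : μ.real ((fun ω => F (Z ω)) ⁻¹' {a})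
      = ∑ z with F z = a, μ.real (Z ⁻¹' {z}) := by
    rw [← measureReal_biUnion_finset (fun z _ z' _ h => ?_) fun z _ => hZ z]
    · congr 1
      ext ω
      simp
    · exact (Set.disjoint_singleton.2 h).preimage Z
  unfold shannonEntropy weightedEntropy
  rw [← Finset.sum_fiberwise _ F, ← Finset.sum_neg_distrib]
  refine Finset.sum_congr rfl fun a _ => ?_
  rw [← measureReal_def, key, Real.negMulLog, neg_mul, Finset.sum_mul]
  congr 1
  refine Finset.sum_congr rfl fun z hz => ?_
  have hz' : F z = a := by simpa using hz
  simp only [fiberMass, hz']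

namespace Scheme

variable {P : Type} [Fintype P] [DecidableEq P]

/-- The shares and the secret of a scheme form a family of random variables on a finite
probability space. -/
theorem exists_jointEntropy (S : Scheme P) :
    ∃ (Ω α : Type) (_ : Fintype Ω) (w : Ω → ℝ) (X : Option P → Ω → α), (∀ z, 0 ≤ w z) ∧
      (∀ Y, S.Hset Y = jointEntropy w X (Y.map .some)) ∧
      ∀ Y, S.HsetS Y = jointEntropy w X (insertNone Y) := by
  let := S.mΩ
  let := S.prob
  let := S.secFin
  let := S.shFin
  let Z : S.Ω → (∀ p, S.ShT p) × S.SecT := fun ω => (fun p => S.share p ω, S.secret ω)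
  have hZ z : MeasurableSet (Z ⁻¹' {z}) := by
    have h : Z ⁻¹' {z} = (⋂ p, S.share p ⁻¹' {z.1 p}) ∩ S.secret ⁻¹' {z.2} := by
      ext ω
      simp [Z, Prod.ext_iff, funext_iff]
    rw [h]
    exact (MeasurableSet.iInter fun p => S.share_meas p _).inter (S.secret_meas _)
  let X : Option P → (∀ p, S.ShT p) × S.SecT → S.SecT ⊕ (Σ p, S.ShT p) := fun o z =>
    o.elim (.inl z.2) fun p => .inr ⟨p, z.1 p⟩
  refine ⟨_, _, inferInstance, fun z => S.μ.real (Z ⁻¹' {z}), X, fun z => measureReal_nonneg,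
    fun Y => ?_, fun Y => ?_⟩
  · refine (shannonEntropy_comp S.μ hZ fun z (p : {y // y ∈ Y}) => z.1 p.1).trans
      (weightedEntropy_congr fun z z' _ _ => ?_)
    rw [restrict_eq_iff]
    simp [X, funext_iff]
  · refine (shannonEntropy_comp S.μ hZ fun z =>
      ((fun p : {y // y ∈ Y} => z.1 p.1), z.2)).trans (weightedEntropy_congr fun z z' _ _ => ?_)
    rw [restrict_eq_iff]
    simp [X, Option.forall, funext_iff, and_comm]

theorem Hset_mono (S : Scheme P) {X Y : Finset P} (h : X ⊆ Y) : S.Hset X ≤ S.Hset Y := by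
  obtain ⟨Ω, α, _, w, F, hw, hF, -⟩ := S.exists_jointEntropy
  rw [hF, hF]
  exact jointEntropy_mono hw F (Finset.map_subset_map.2 h)

theorem Hset_submodular (S : Scheme P) (X Y : Finset P) :
    S.Hset (X ∪ Y) + S.Hset (X ∩ Y) ≤ S.Hset X + S.Hset Y := by
  obtain ⟨Ω, α, _, w, F, hw, hF, -⟩ := S.exists_jointEntropy
  simpa only [hF, Finset.map_union, Finset.map_inter] using
    jointEntropy_submodular hw F (X.map .some) (Y.map .some)

/-- Submodularity is strict for qualified sets with an unqualified intersection. -/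
theorem IsPerfect.Hset_submodular {S : Scheme P} {Γ : Finset P → Prop} (hS : S.IsPerfect Γ)
    {X Y : Finset P} (hX : Γ X) (hY : Γ Y) (h : ¬ Γ (X ∩ Y)) :
    S.Hset (X ∪ Y) + S.Hset (X ∩ Y) + S.Hsec ≤ S.Hset X + S.Hset Y := by
  have h₁ := hS.1 X hX
  have h₂ := hS.1 Y hY
  have h₃ := hS.2 _ h
  obtain ⟨Ω, α, _, w, F, hw, hF, hFS⟩ := S.exists_jointEntropy
  have h₄ : S.Hset (X ∪ Y) ≤ S.HsetS (X ∪ Y) := by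
    rw [hF, hFS]
    exact jointEntropy_mono hw F fun i hi => by aesop
  have h₅ : S.HsetS (X ∪ Y) + S.HsetS (X ∩ Y) ≤ S.HsetS X + S.HsetS Y := by
    have hU : insertNone (X ∪ Y) = insertNone X ∪ insertNone Y := by
      ext (_ | p) <;> simp
    have hI : insertNone (X ∩ Y) = insertNone X ∩ insertNone Y := by
      ext (_ | p) <;> simp
    rw [hFS, hFS, hFS, hFS, hU, hI]
    exact jointEntropy_submodular hw F _ _
  linarith

theorem Hset_nonShannon (S : Scheme P) (A B C D : Finset P) :
    0 ≤ -5 * S.Hset A - 5 * S.Hset B - S.Hset C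
      + 8 * S.Hset (A ∪ B) + 6 * S.Hset (A ∪ C) + 6 * S.Hset (B ∪ C)
      - 9 * S.Hset (A ∪ B ∪ C) + 2 * S.Hset (A ∪ D) + 2 * S.Hset (B ∪ D)
      - 2 * S.Hset (C ∪ D) - 2 * S.Hset (A ∪ B ∪ D) := by
  obtain ⟨Ω, α, _, w, F, hw, hF, -⟩ := S.exists_jointEntropy
  let G : ℕ → Finset (Option P) := fun n =>
    (if n = 0 then A else if n = 1 then B else if n = 2 then C else D).map .some
  have h := jointEntropy_nonShannon hw fun n ω i => if i ∈ G n then some (F i ω) else none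
  simp only [jointEntropy_biUnion] at h
  simp only [hF]
  convert h using 1
  simp [G, Finset.map_union, Finset.union_comm, Finset.union_left_comm]

end Scheme

end Scheme

section Vamos

/-- The circuits of the Vamos matroid with four elements. -/
def vamosPlanes : Finset (Finset (Fin 8)) :=
  {pairA ∪ pairB, pairA ∪ pairC, pairB ∪ pairC, pairB ∪ pairD, pairC ∪ pairD}

theorem vamosDep_iff {X : Finset (Fin 8)} : VamosDep X ↔ X ∈ vamosPlanes ∨ 5 ≤ #X := by
  simp [VamosDep, vamosPlanes, or_assoc]

theorem vamosCircuit_of_card_le {X : Finset (Fin 8)} (hX : X ∈ vamosPlanes ∨ 5 ≤ #X)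
    (hcard : #X ≤ 5) (h : ∀ Z ∈ vamosPlanes, ¬ Z ⊂ X) : VamosCircuit X := by
  refine ⟨vamosDep_iff.2 hX, fun Y hY hdep => ?_⟩
  rcases vamosDep_iff.1 hdep with hY' | hY'
  · exact h Y hY' hY
  · have := card_lt_card hY
    omega

theorem not_vamosQualified_of_card_le {x : Fin 8} {Y : Finset (Fin 8)} (hx : x ∉ Y)
    (hcard : #Y ≤ 3 ∨ #Y = 4 ∧ Y ∈ vamosPlanes)
    (h : ∀ Z ∈ vamosPlanes, x ∈ Z → ¬ Z ⊆ insert x Y) : ¬ VamosQualified x Y := by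
  rintro (hxY | ⟨M, hM, hxM, hdep, hmin⟩)
  · exact hx hxY
  rcases vamosDep_iff.1 hdep with hZ | h5
  · exact h _ hZ (mem_insert_self x M) (insert_subset_insert x hM)
  · rw [card_insert_of_notMem hxM] at h5
    have hle := card_le_card hM
    rcases hcard with h3 | ⟨h4, hY⟩
    · omega
    · obtain rfl := eq_of_subset_of_card_le hM (by omega)
      exact hmin M (ssubset_insert hxM) (vamosDep_iff.2 (.inl hY))

theorem vamosQualified_of_mem_pairA {x : Fin 8} (hx : x ∈ pairA) :
    VamosQualified x (pairB ∪ pairC ∪ pairD) ∧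
      VamosQualified x (pairA.erase x ∪ pairC ∪ pairD) := by
  refine ⟨.inr ⟨{2, 3, 4, 6}, by decide, ?_, vamosCircuit_of_card_le ?_ ?_ ?_⟩,
    .inr ⟨pairA.erase x ∪ pairC, subset_union_left, ?_, vamosCircuit_of_card_le ?_ ?_ ?_⟩⟩ <;>
  · revert x
    decide +kernel

theorem not_vamosQualified_of_mem_pairA {x : Fin 8} (hx : x ∈ pairA) :
    ¬ VamosQualified x (pairB ∪ pairC) ∧ ¬ VamosQualified x (pairC ∪ pairD) ∧
      ¬ VamosQualified x (pairA.erase x ∪ pairD) := by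
  refine ⟨not_vamosQualified_of_card_le ?_ ?_ ?_, not_vamosQualified_of_card_le ?_ ?_ ?_,
    not_vamosQualified_of_card_le ?_ ?_ ?_⟩ <;>
  · revert x
    decide +kernel

/-- The inequality for a dealer in the pair `A` in terms of entropies that are not normalized. -/
theorem sixteen_mul_Hsec_le (x : Fin 8) (hx : x ∈ pairA) (S : Scheme (Fin 8))
    (hperf : S.IsPerfect (VamosQualified x)) :
    16 * S.Hsec ≤ 5 * (S.Hset (pairA ∪ pairB) - S.Hset pairB)
      + (S.Hset (pairB ∪ pairA) - S.Hset pairA) + 6 * (S.Hset (pairA ∪ pairC) - S.Hset pairC)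
      + 2 * (S.Hset (pairB ∪ pairD) - S.Hset pairD) := by
  obtain ⟨hBCD, hTCD⟩ := vamosQualified_of_mem_pairA hx
  obtain ⟨hBC, hCD, hTD⟩ := not_vamosQualified_of_mem_pairA hx
  have hA (Y : Finset (Fin 8)) : VamosQualified x (pairA ∪ Y) := .inl (mem_union_left Y hx)
  have hT : ∀ x ∈ pairA, (pairA ∪ pairD) ∪ (pairA.erase x ∪ pairC ∪ pairD)
      = pairA ∪ (pairC ∪ pairD) ∧
      (pairA ∪ pairD) ∩ (pairA.erase x ∪ pairC ∪ pairD) = pairA.erase x ∪ pairD ∧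
      (pairC ∪ pairD) ∪ (pairA.erase x ∪ pairD) = pairA.erase x ∪ pairC ∪ pairD ∧
      (pairC ∪ pairD) ∩ (pairA.erase x ∪ pairD) = pairD := by decide
  obtain ⟨hT₁, hT₂, hT₃, hT₄⟩ := hT x hx
  have h₁ := S.Hset_nonShannon pairB pairC pairA pairD
  have h₂ := S.Hset_submodular (pairC ∪ pairD) (pairA.erase x ∪ pairD)
  have h₃ := hperf.Hset_submodular (hA pairD) hTCD (hT₂ ▸ hTD)
  have h₄ : S.Hset (pairB ∪ pairC ∪ pairD) ≤ S.Hset (pairA ∪ (pairB ∪ pairC ∪ pairD)) :=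
    S.Hset_mono subset_union_right
  have h₅ : S.Hset (pairA ∪ (pairC ∪ pairD)) ≤ S.Hset (pairA ∪ (pairB ∪ pairC ∪ pairD)) :=
    S.Hset_mono (by decide)
  have h₆ := S.Hset_submodular (pairB ∪ pairC) (pairC ∪ pairD)
  have h₇ := hperf.Hset_submodular (hA (pairB ∪ pairC)) hBCD
    ((by decide : (pairA ∪ (pairB ∪ pairC)) ∩ (pairB ∪ pairC ∪ pairD) = pairB ∪ pairC) ▸ hBC)
  have h₈ := hperf.Hset_submodular (hA (pairC ∪ pairD)) hBCD
    ((by decide : (pairA ∪ (pairC ∪ pairD)) ∩ (pairB ∪ pairC ∪ pairD) = pairC ∪ pairD) ▸ hCD)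
  rw [hT₃, hT₄] at h₂
  rw [hT₁, hT₂] at h₃
  rw [show (pairB ∪ pairC) ∪ (pairC ∪ pairD) = pairB ∪ pairC ∪ pairD by decide,
    show (pairB ∪ pairC) ∩ (pairC ∪ pairD) = pairC by decide] at h₆
  rw [show pairA ∪ (pairB ∪ pairC) ∪ (pairB ∪ pairC ∪ pairD)
      = pairA ∪ (pairB ∪ pairC ∪ pairD) by decide,
    show (pairA ∪ (pairB ∪ pairC)) ∩ (pairB ∪ pairC ∪ pairD) = pairB ∪ pairC by decide] at h₇
  rw [show pairA ∪ (pairC ∪ pairD) ∪ (pairB ∪ pairC ∪ pairD)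
      = pairA ∪ (pairB ∪ pairC ∪ pairD) by decide,
    show (pairA ∪ (pairC ∪ pairD)) ∩ (pairB ∪ pairC ∪ pairD) = pairC ∪ pairD by decide] at h₈
  rw [union_comm _ pairA, union_comm _ pairA, union_comm _ pairA] at h₁
  rw [union_comm pairB pairA]
  linarith

end Vamos

/-- If the dealer is a member of the Vamos pair `A`, then
`16 ≤ 5·h(A|B) + h(B|A) + 6·h(A|C) + 2·h(B|D)`. -/
theorem dealer_in_A_ineq (x : Fin 8) (hx : x ∈ pairA)
    (S : Scheme (Fin 8)) (hperf : S.IsPerfect (VamosQualified x)) (hpos : 0 < S.Hsec) :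
    16 ≤ 5 * S.hcond pairA pairB + S.hcond pairB pairA
        + 6 * S.hcond pairA pairC + 2 * S.hcond pairB pairD := by
  have h := sixteen_mul_Hsec_le x hx S hperf
  unfold Scheme.hcond Scheme.hset
  rw [← mul_le_mul_iff_left₀ hpos]
  calc 16 * S.Hsec ≤ _ := h
    _ = _ := by field_simp
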